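/- Suppose Z = diag(I_r, 0) is a maximum rank slack of the feasible semidefinite system (P_SD), i.e., Z is a slack and every slack has rank at most r. Then every slack S of (P_SD) has its last n−r rows and columns equal to zero. -/

import Mathlib

open Matrix

/-- Trace inner product `S • T = trace(ST)` of square real matrices. -/
noncomputable def ip {k : ℕ} (S T : Matrix (Fin k) (Fin k) ℝ) : ℝ :=
  Matrix.trace (S * T)

/-- `x` is feasible for the semidefinite system `∑ xᵢ Aᵢ ⪯ B`. -/
def IsFeasible {n m : ℕ} (A : Fin m → Matrix (Fin n) (Fin n) ℝ)
    (B : Matrix (Fin n) (Fin n) ℝ) (x : Fin m → ℝ) : Prop :=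
  (B - ∑ i, x i • A i).PosSemidef

/-- The set of primal objective values `∑ cᵢ xᵢ` over feasible `x`. -/
def PrimalVals {n m : ℕ} (A : Fin m → Matrix (Fin n) (Fin n) ℝ)
    (B : Matrix (Fin n) (Fin n) ℝ) (c : Fin m → ℝ) : Set ℝ :=
  {s | ∃ x : Fin m → ℝ, IsFeasible A B x ∧ s = ∑ i, c i * x i}

/-- The system `∑ xᵢ Aᵢ ⪯ B` is badly behaved: for some `c` the primal optimal
value is finite (i.e. is a least upper bound `v`), but no dual feasible `Y`
achieves value `v`. -/
def BadlyBehaved {n m : ℕ} (A : Fin m → Matrix (Fin n) (Fin n) ℝ)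
    (B : Matrix (Fin n) (Fin n) ℝ) : Prop :=
  ∃ (c : Fin m → ℝ) (v : ℝ), IsLUB (PrimalVals A B c) v ∧
    ¬ ∃ Y : Matrix (Fin n) (Fin n) ℝ,
        Y.PosSemidef ∧ (∀ i, ip (A i) Y = c i) ∧ ip B Y = v

/-- `Zmat n r = diag(I_r, 0)`. -/
def Zmat (n r : ℕ) : Matrix (Fin n) (Fin n) ℝ :=
  Matrix.of fun i j => if i = j ∧ (i : ℕ) < r then (1 : ℝ) else 0

/-- `Zmat n r` is a maximum rank slack of `∑ xᵢ Aᵢ ⪯ B`: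
it is a slack and every slack has rank at most `r`. -/
def MaxRankSlack {n m : ℕ} (A : Fin m → Matrix (Fin n) (Fin n) ℝ)
    (B : Matrix (Fin n) (Fin n) ℝ) (r : ℕ) : Prop :=
  (∃ x : Fin m → ℝ, B - ∑ i, x i • A i = Zmat n r) ∧
  ∀ x : Fin m → ℝ, IsFeasible A B x → (B - ∑ i, x i • A i).rank ≤ r

/-- Lower-right `(n-r) × (n-r)` block. -/
def block22 {n : ℕ} (r : ℕ) (h : r ≤ n) (V : Matrix (Fin n) (Fin n) ℝ) :
    Matrix (Fin (n - r)) (Fin (n - r)) ℝ :=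
  Matrix.of fun i j => V ⟨r + i.1, by omega⟩ ⟨r + j.1, by omega⟩

/-- Upper-right `r × (n-r)` block. -/
def block12 {n : ℕ} (r : ℕ) (h : r ≤ n) (V : Matrix (Fin n) (Fin n) ℝ) :
    Matrix (Fin r) (Fin (n - r)) ℝ :=
  Matrix.of fun i j => V ⟨i.1, by omega⟩ ⟨r + j.1, by omega⟩

/-- The column space (range space) of a matrix. -/
def colSpace {p q : ℕ} (M : Matrix (Fin p) (Fin q) ℝ) : Submodule ℝ (Fin p → ℝ) :=
  LinearMap.range M.mulVecLin

/-- The "Bad condition": some linear combination `V` of the `Aᵢ` has `V₂₂ ⪰ 0`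
and `ℛ(V₁₂ᵀ) ⊄ ℛ(V₂₂)`. -/
def BadCond {n m : ℕ} (A : Fin m → Matrix (Fin n) (Fin n) ℝ) (r : ℕ) (h : r ≤ n) : Prop :=
  ∃ lam : Fin m → ℝ,
    (block22 r h (∑ i, lam i • A i)).PosSemidef ∧
    ¬ colSpace (block12 r h (∑ i, lam i • A i))ᵀ ≤
        colSpace (block22 r h (∑ i, lam i • A i))

/-- `padLow r h U = diag(0, U)` as an `n × n` matrix. -/
def padLow {n : ℕ} (r : ℕ) (h : r ≤ n) (U : Matrix (Fin (n - r)) (Fin (n - r)) ℝ) :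
    Matrix (Fin n) (Fin n) ℝ :=
  Matrix.of fun a b =>
    if hab : r ≤ (a : ℕ) ∧ r ≤ (b : ℕ) then U ⟨a.1 - r, by omega⟩ ⟨b.1 - r, by omega⟩
    else 0

/-- "Good condition 1": some positive definite `U` has `Aᵢ • diag(0, U) = 0` for all `i`. -/
def GoodCond1 {n m : ℕ} (A : Fin m → Matrix (Fin n) (Fin n) ℝ) (r : ℕ) (h : r ≤ n) : Prop :=
  ∃ U : Matrix (Fin (n - r)) (Fin (n - r)) ℝ, U.PosDef ∧ ∀ i, ip (A i) (padLow r h U) = 0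

/-- "Good condition 2": every linear combination of the `Aᵢ` with zero lower-right
block has zero upper-right block. -/
def GoodCond2 {n m : ℕ} (A : Fin m → Matrix (Fin n) (Fin n) ℝ) (r : ℕ) (h : r ≤ n) : Prop :=
  ∀ lam : Fin m → ℝ, block22 r h (∑ i, lam i • A i) = 0 →
    block12 r h (∑ i, lam i • A i) = 0

/-- `Tmat r h N = [[I_r, 0], [0, N]]`. -/
def Tmat {n : ℕ} (r : ℕ) (h : r ≤ n) (N : Matrix (Fin (n - r)) (Fin (n - r)) ℝ) :
    Matrix (Fin n) (Fin n) ℝ :=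
  Matrix.of fun a b =>
    if (a : ℕ) < r ∧ (b : ℕ) < r then (if a = b then (1 : ℝ) else 0)
    else if hab : r ≤ (a : ℕ) ∧ r ≤ (b : ℕ) then N ⟨a.1 - r, by omega⟩ ⟨b.1 - r, by omega⟩
    else 0

/-- The system `∑ xᵢ A'ᵢ ⪯ B'` is an elementary reformulation of `∑ xᵢ Aᵢ ⪯ B`:
there are an invertible `M : ℝ^{m×m}`, a vector `μ ∈ ℝ^m` and an invertible
`T = [[I_r, 0], [0, N]]` with `A'ᵢ = Tᵀ (∑ⱼ Mᵢⱼ Aⱼ) T` and `B' = Tᵀ (B + ∑ⱼ μⱼ Aⱼ) T`. -/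
def ElemReform {n m : ℕ} (r : ℕ) (h : r ≤ n)
    (A : Fin m → Matrix (Fin n) (Fin n) ℝ) (B : Matrix (Fin n) (Fin n) ℝ)
    (A' : Fin m → Matrix (Fin n) (Fin n) ℝ) (B' : Matrix (Fin n) (Fin n) ℝ) : Prop :=
  ∃ (M : Matrix (Fin m) (Fin m) ℝ) (μ : Fin m → ℝ)
    (N : Matrix (Fin (n - r)) (Fin (n - r)) ℝ),
    IsUnit M ∧ IsUnit (Tmat r h N) ∧
    (∀ i, A' i = (Tmat r h N)ᵀ * (∑ j, M i j • A j) * Tmat r h N) ∧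
    B' = (Tmat r h N)ᵀ * (B + ∑ j, μ j • A j) * Tmat r h N

/-- The last `n - r` columns of a square matrix, as an `n × (n-r)` matrix. -/
def lastCols {n : ℕ} (r : ℕ) (h : r ≤ n) (V : Matrix (Fin n) (Fin n) ℝ) :
    Matrix (Fin n) (Fin (n - r)) ℝ :=
  Matrix.of fun a j => V a ⟨r + j.1, by omega⟩

/-- Bad normal form of a semidefinite system. -/
def BadNormalForm {n m : ℕ} (A : Fin m → Matrix (Fin n) (Fin n) ℝ)
    (B : Matrix (Fin n) (Fin n) ℝ) (r : ℕ) (h : r ≤ n) : Prop :=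
  B = Zmat n r ∧ MaxRankSlack A B r ∧
  ∃ k : ℕ, ∃ hk : k < m,
    (∀ i : Fin m, (i : ℕ) < k → ∀ a b : Fin n, r ≤ (b : ℕ) → A i a b = 0) ∧
    (∀ i : Fin m, (i : ℕ) < k → ∀ a b : Fin n, r ≤ (a : ℕ) → A i a b = 0) ∧
    LinearIndependent ℝ (fun i : Fin (m - k) => lastCols r h (A ⟨k + i.1, by omega⟩)) ∧
    (block22 r h (A ⟨m - 1, by omega⟩)).PosSemidef

/-- Good normal form of a semidefinite system. -/
def GoodNormalForm {n m : ℕ} (A : Fin m → Matrix (Fin n) (Fin n) ℝ)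
    (B : Matrix (Fin n) (Fin n) ℝ) (r : ℕ) (h : r ≤ n) : Prop :=
  B = Zmat n r ∧ MaxRankSlack A B r ∧
  ∃ k : ℕ, ∃ _hk : k ≤ m,
    (∀ i : Fin m, (i : ℕ) < k → ∀ a b : Fin n,
        (r ≤ (a : ℕ) ∨ r ≤ (b : ℕ)) → A i a b = 0) ∧
    LinearIndependent ℝ (fun i : Fin (m - k) => block22 r h (A ⟨k + i.1, by omega⟩)) ∧
    ∃ U : Matrix (Fin (n - r)) (Fin (n - r)) ℝ, U.PosDef ∧
      ∀ i : Fin m, k ≤ (i : ℕ) → ip (block22 r h (A i)) U = 0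

/-- The image of the positive semidefinite cone under `Y ↦ (A₁ • Y, …, A_m • Y)`. -/
def imageSet {n m : ℕ} (A : Fin m → Matrix (Fin n) (Fin n) ℝ) : Set (Fin m → ℝ) :=
  {y | ∃ Y : Matrix (Fin n) (Fin n) ℝ, Y.PosSemidef ∧ ∀ i, ip (A i) Y = y i}

/-- The kernel of a sum of positive semidefinite matrices is contained in the kernel of each. -/
theorem Matrix.PosSemidef.mulVec_eq_zero_of_add {ι : Type*} [Fintype ι] {P Q : Matrix ι ι ℝ}
    (hP : P.PosSemidef) (hQ : Q.PosSemidef) {v : ι → ℝ} (h : (P + Q) *ᵥ v = 0) :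
    P *ᵥ v = 0 ∧ Q *ᵥ v = 0 := by
  have hsum : star v ⬝ᵥ P *ᵥ v + star v ⬝ᵥ Q *ᵥ v = 0 := by
    rw [← dotProduct_add, ← add_mulVec, h, dotProduct_zero]
  have hPv := hP.dotProduct_mulVec_nonneg v
  have hQv := hQ.dotProduct_mulVec_nonneg v
  exact ⟨(hP.dotProduct_mulVec_zero_iff v).1 (by linarith),
    (hQ.dotProduct_mulVec_zero_iff v).1 (by linarith)⟩

/-- If adding a positive semidefinite `Q` to a positive semidefinite `P` does not increase the
rank, then the kernel of `P` is contained in the kernel of `Q`. -/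
theorem Matrix.PosSemidef.mulVec_eq_zero_of_rank_add_le {ι : Type*} [Fintype ι]
    {P Q : Matrix ι ι ℝ} (hP : P.PosSemidef) (hQ : Q.PosSemidef)
    (hrank : (P + Q).rank ≤ P.rank) {v : ι → ℝ} (hv : P *ᵥ v = 0) : Q *ᵥ v = 0 := by
  have hle : LinearMap.ker (P + Q).mulVecLin ≤ LinearMap.ker P.mulVecLin := fun w hw =>
    (hP.mulVec_eq_zero_of_add hQ (by simpa only [LinearMap.mem_ker, mulVecLin_apply] using hw)).1
  have h₁ := (P + Q).mulVecLin.finrank_range_add_finrank_ker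
  have h₂ := P.mulVecLin.finrank_range_add_finrank_ker
  have heq := Submodule.eq_of_le_of_finrank_le hle (by unfold Matrix.rank at hrank; omega)
  have hmem : v ∈ LinearMap.ker (P + Q).mulVecLin := by
    rw [heq]; exact hv
  exact (hP.mulVec_eq_zero_of_add hQ hmem).2

theorem Zmat_eq_diagonal (n r : ℕ) :
    Zmat n r = Matrix.diagonal fun i : Fin n => if (i : ℕ) < r then (1 : ℝ) else 0 := by
  ext i j
  simp only [Zmat, of_apply, diagonal_apply, ite_and]

theorem posSemidef_Zmat (n r : ℕ) : (Zmat n r).PosSemidef := by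
  rw [Zmat_eq_diagonal]
  exact PosSemidef.diagonal fun i => by dsimp only [Pi.zero_apply]; split_ifs <;> norm_num

theorem rank_Zmat {n r : ℕ} (h : r ≤ n) : (Zmat n r).rank = r := by
  rw [Zmat_eq_diagonal, rank_diagonal, Fintype.card_subtype]
  simp [Fin.card_filter_val_lt, h]

/-- If `Z = diag(I_r, 0)` is a maximum rank slack of the feasible
system, then every slack has its last `n - r` rows and columns equal to zero. -/
theorem stmt4 {n m : ℕ} (hn : 0 < n) (hm : 0 < m)
    (A : Fin m → Matrix (Fin n) (Fin n) ℝ) (B : Matrix (Fin n) (Fin n) ℝ)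
    (hA : ∀ i, (A i).IsSymm) (hB : B.IsSymm)
    (hfeas : ∃ x : Fin m → ℝ, IsFeasible A B x)
    (r : ℕ) (hr : r ≤ n) (hZ : MaxRankSlack A B r)
    (x : Fin m → ℝ) (hx : IsFeasible A B x) :
    ∀ a b : Fin n, (r ≤ (a : ℕ) ∨ r ≤ (b : ℕ)) → (B - ∑ i, x i • A i) a b = 0 := by
  obtain ⟨⟨z, hz⟩, hmax⟩ := hZ
  set S := B - ∑ i, x i • A i with hS
  have hSpsd : S.PosSemidef := hx
  have hmid : B - ∑ i, ((1 / 2 : ℝ) • (z + x)) i • A i = (1 / 2 : ℝ) • (Zmat n r + S) := by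
    rw [← hz, hS]
    simp only [Pi.smul_apply, Pi.add_apply, smul_assoc, add_smul, ← Finset.smul_sum,
      Finset.sum_add_distrib]
    module
  have hpsd := (posSemidef_Zmat n r).add hSpsd
  have hrank : (Zmat n r + S).rank ≤ (Zmat n r).rank := by
    have h := hmax ((1 / 2 : ℝ) • (z + x)) (by
      rw [IsFeasible, hmid]
      exact hpsd.smul (by norm_num))
    rw [rank_Zmat hr]
    rwa [hmid, rank_smul_of_mem_nonZeroDivisors _
      (mem_nonZeroDivisors_of_ne_zero (by norm_num))] at h
  have hcol : ∀ a b : Fin n, r ≤ (b : ℕ) → S a b = 0 := fun a b hb => by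
    have hker : Zmat n r *ᵥ Pi.single b 1 = 0 := by
      ext i
      simp only [mulVec_single_one, col_apply, Zmat, of_apply, Pi.zero_apply]
      exact if_neg (by rintro ⟨rfl, hi⟩; omega)
    have h := (posSemidef_Zmat n r).mulVec_eq_zero_of_rank_add_le hSpsd hrank hker
    simpa using congrFun h a
  rintro a b (ha | hb)
  · rw [← hSpsd.isHermitian.apply, hcol b a ha, star_zero]
  · exact hcol a b hb
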